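/- arXiv:2506.11450 — 4 statements merged into one kernel-verified Lean document; each statement's English description precedes it below -/
import Mathlib

section
/- Let r = 1 and let d be an integer with 5 ≤ d ≤ 10. The polynomial f = x₁^d x₂³ + x₃^{d−3}x₄³ + x₃^d x₂³ + x₁^{d−3}x₄³ ∈ S_{(d,3)} is nondegenerate: every common zero p ∈ ℂ⁴ of the four polynomials x₁·∂f/∂x₁, x₂·∂f/∂x₂, x₃·∂f/∂x₃, x₄·∂f/∂x₄ satisfies p₃p₄ = p₁p₄ = p₁p₂ = p₂p₃ = 0, i.e., p lies in the exceptional set Z(Σ). -/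
open MvPolynomial

noncomputable section

/-- The Cox ring of the Hirzebruch surface: `ℂ[x₁,x₂,x₃,x₄]`. -/
abbrev S : Type := MvPolynomial (Fin 4) ℂ

/-- The ℤ²-degree of a monomial exponent vector for the Hirzebruch grading:
`deg x₁ = deg x₃ = (1,0)`, `deg x₂ = (0,1)`, `deg x₄ = (r,1)`. -/
def wdeg (r : ℕ) (c : Fin 4 →₀ ℕ) : ℤ × ℤ :=
  ((c 0 : ℤ) + (c 2 : ℤ) + (r : ℤ) * (c 3 : ℤ), (c 1 : ℤ) + (c 3 : ℤ))

/-- The graded piece `S_γ`: the span of monomials of degree `γ`. -/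
def Sgr (r : ℕ) (γ : ℤ × ℤ) : Submodule ℂ S where
  carrier := {f : S | ∀ c ∈ f.support, wdeg r c = γ}
  add_mem' := by
    intro f g hf hg c hc
    rcases Finset.mem_union.mp (MvPolynomial.support_add hc) with h | h
    · exact hf c h
    · exact hg c h
  zero_mem' := by
    intro c hc
    simp at hc
  smul_mem' := by
    intro t f hf c hc
    exact hf c (MvPolynomial.support_smul hc)

/-- The ideal `J₀(f)`, generated by `xᵢ ∂f/∂xᵢ`, `i = 1,…,4`. -/
def J0 (f : S) : Ideal S :=
  Ideal.span {g : S | ∃ i : Fin 4, g = X i * pderiv i f}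

/-- The ideal quotient `J₁(f) = J₀(f) : (x₁x₂x₃x₄)`. -/
def J1 (f : S) : Ideal S :=
  Submodule.colon (J0 f) (Ideal.span {(X 0 * X 1 * X 2 * X 3 : S)})

/-- The exceptional set `Z(Σ)` of the quotient construction of the Hirzebruch surface. -/
def Zexc : Set (Fin 4 → ℂ) :=
  {p | p 2 * p 3 = 0 ∧ p 0 * p 3 = 0 ∧ p 0 * p 1 = 0 ∧ p 1 * p 2 = 0}

/-- `f` is nondegenerate: `x₁∂f/∂x₁, …, x₄∂f/∂x₄` have no common zero outside `Z(Σ)`. -/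
def Nondeg (f : S) : Prop :=
  ∀ p : Fin 4 → ℂ, p ∉ Zexc → ∃ i : Fin 4, eval p (X i * pderiv i f) ≠ 0

/-- The graded piece `R₁(f)_γ = S_γ/(J₁(f) ∩ S_γ)`, realized as the image of `S_γ`
in the quotient ring `S ⧸ J₁(f)`. -/
def R1 (r : ℕ) (f : S) (γ : ℤ × ℤ) : Submodule ℂ (S ⧸ J1 f) :=
  (Sgr r γ).map (Ideal.Quotient.mkₐ ℂ (J1 f)).toLinearMap

/-- Nondegeneracy (on both sides) of the multiplication pairing
`R₁(f)_γ × R₁(f)_γ' → R₁(f)_{γ+γ'}`, stated elementwise: a class `[x]` is nonzero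
iff `x ∉ J₁(f)`, and the pairing of `[x]` and `[y]` is nonzero iff `x*y ∉ J₁(f)`. -/
def NondegPair (r : ℕ) (f : S) (γ γ' : ℤ × ℤ) : Prop :=
  (∀ x ∈ Sgr r γ, x ∉ J1 f → ∃ y ∈ Sgr r γ', x * y ∉ J1 f) ∧
  (∀ y ∈ Sgr r γ', y ∉ J1 f → ∃ x ∈ Sgr r γ, x * y ∉ J1 f)

/-- A product of powers of two variables lies in the graded piece of its degree. -/
lemma X_pow_mul_X_pow_mem_Sgr (r : ℕ) (i j : Fin 4) (m n : ℕ) :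
    (X i ^ m * X j ^ n : S) ∈ Sgr r (wdeg r (Finsupp.single i m + Finsupp.single j n)) := by
  intro c hc
  rw [X_pow_eq_monomial, X_pow_eq_monomial, monomial_mul, one_mul] at hc
  rw [Finset.mem_singleton.mp (support_monomial_subset hc)]

/-- The powers `m` and `m + 3` of the ratio of two nonzero complex numbers are not both `-1`. -/
lemma false_of_pow_eq_neg_pow {x z : ℂ} {m : ℕ} (hx : x ≠ 0) (hz : z ≠ 0)
    (h₁ : x ^ m = -z ^ m) (h₂ : x ^ (m + 3) = -z ^ (m + 3)) : False := by
  have h₃ : x ^ 3 = z ^ 3 := by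
    refine mul_left_cancel₀ (pow_ne_zero m hx) ?_
    rw [← pow_add, h₂, h₁, pow_add]
    ring
  have h₄ : (z ^ m) ^ 3 = -(z ^ m) ^ 3 := by
    calc (z ^ m) ^ 3 = (z ^ 3) ^ m := pow_right_comm z m 3
      _ = (x ^ m) ^ 3 := by rw [← h₃, pow_right_comm]
      _ = -(z ^ m) ^ 3 := by rw [h₁]; ring
  exact pow_ne_zero 3 (pow_ne_zero m hz) (self_eq_neg.mp h₄)

/-- for `r = 1`, `5 ≤ d ≤ 10`, the polynomial
`f = x₁^d x₂³ + x₃^{d−3}x₄³ + x₃^d x₂³ + x₁^{d−3}x₄³ ∈ S_{(d,3)}` is nondegenerate: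
every common zero of `x₁∂f/∂x₁, …, x₄∂f/∂x₄` lies in the exceptional set `Z(Σ)`. -/
theorem stmt_4 (d : ℕ) (hd5 : 5 ≤ d) (hd10 : d ≤ 10) (f : S)
    (hf : f = X 0 ^ d * X 1 ^ 3 + X 2 ^ (d - 3) * X 3 ^ 3
            + X 2 ^ d * X 1 ^ 3 + X 0 ^ (d - 3) * X 3 ^ 3) :
    f ∈ Sgr 1 ((d : ℤ), 3) ∧
    ∀ p : Fin 4 → ℂ, (∀ i : Fin 4, eval p (X i * pderiv i f) = 0) → p ∈ Zexc := by
  obtain ⟨k, rfl⟩ : ∃ k, d = k + 1 + 3 := ⟨d - 4, by omega⟩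
  rw [Nat.add_sub_cancel] at hf
  subst hf
  constructor
  · refine add_mem (add_mem (add_mem ?_ ?_) ?_) ?_ <;>
      convert X_pow_mul_X_pow_mem_Sgr 1 _ _ _ _ using 2 <;>
      simp [wdeg]
  · intro p hp
    have h₀ := hp 0
    have h₁ := hp 1
    have h₃ := hp 3
    simp [pderiv_X, Derivation.leibniz, Derivation.leibniz_pow, -mul_eq_zero] at h₀ h₁ h₃
    set x := p 0
    set y := p 1
    set z := p 2
    set w := p 3
    have hm : (k : ℂ) + 1 ≠ 0 := by exact_mod_cast Nat.succ_ne_zero k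
    have hd : (k : ℂ) + 1 + 3 ≠ 0 := by exact_mod_cast Nat.succ_ne_zero (k + 3)
    have hx : ((k : ℂ) + 1 + 3) * (x ^ (k + 1 + 3) * y ^ 3)
        + (k + 1) * (x ^ (k + 1) * w ^ 3) = 0 := by
      linear_combination h₀
    have hy : x ^ (k + 1 + 3) * y ^ 3 + z ^ (k + 1 + 3) * y ^ 3 = 0 := by
      linear_combination h₁ / 3
    have hw : z ^ (k + 1) * w ^ 3 + x ^ (k + 1) * w ^ 3 = 0 := by
      linear_combination h₃ / 3
    have ha : x ^ (k + 1 + 3) * y ^ 3 = 0 := by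
      by_contra ha
      have hc : z ^ (k + 1 + 3) * y ^ 3 ≠ 0 := fun h => ha (by simpa [h] using hy)
      have he : x ^ (k + 1) * w ^ 3 ≠ 0 := fun h => by
        rw [h, mul_zero, add_zero] at hx
        exact (mul_ne_zero hd ha) hx
      have hx0 : x ≠ 0 := by rintro h; simp [h] at ha
      have hy0 : y ≠ 0 := by rintro h; simp [h] at ha
      have hz0 : z ≠ 0 := by rintro h; simp [h] at hc
      have hw0 : w ≠ 0 := by rintro h; simp [h] at he
      refine false_of_pow_eq_neg_pow (m := k + 1) hx0 hz0
        (mul_right_cancel₀ (pow_ne_zero 3 hw0) ?_) (mul_right_cancel₀ (pow_ne_zero 3 hy0) ?_)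
      · linear_combination hw
      · linear_combination hy
    have hc : z ^ (k + 1 + 3) * y ^ 3 = 0 := by simpa [ha] using hy
    have he : x ^ (k + 1) * w ^ 3 = 0 := by
      rw [ha, mul_zero, zero_add] at hx
      exact (mul_eq_zero.mp hx).resolve_left hm
    have hb : z ^ (k + 1) * w ^ 3 = 0 := by simpa [he] using hw
    have key {s t : ℂ} {a b : ℕ} (h : s ^ a * t ^ b = 0) : s * t = 0 :=
      mul_eq_zero.mpr ((mul_eq_zero.mp h).imp eq_zero_of_pow_eq_zero eq_zero_of_pow_eq_zero)
    exact ⟨key hb, key he, key ha, (mul_comm y z).trans (key hc)⟩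
end
end

section
/- Let r = 1 and let d be an integer with 5 ≤ d ≤ 10, and let f = x₁^d x₂³ + x₃^{d−3}x₄³ + x₃^d x₂³ + x₁^{d−3}x₄³ ∈ S_{(d,3)}. Then dim_ℂ R₁(f)_{(d,3)} = 4d − 9; equivalently, since dim_ℂ S_{(d,3)} = 4d − 2, the degree-(d,3) graded piece of the ideal J₁(f) has dimension dim_ℂ (J₁(f) ∩ S_{(d,3)}) = 7. -/
open MvPolynomial

noncomputable section

/-- The exponent vector `(i, j, k, l)`. -/
def expo (i j k l : ℕ) : Fin 4 →₀ ℕ := Finsupp.equivFunOnFinite.symm ![i, j, k, l]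

lemma expo_le_expo (i j k l i' j' k' l' : ℕ) :
    expo i j k l ≤ expo i' j' k' l' ↔ i ≤ i' ∧ j ≤ j' ∧ k ≤ k' ∧ l ≤ l' := by
  simp [Finsupp.le_def, Fin.forall_fin_succ, expo]

lemma expo_inj (i j k l i' j' k' l' : ℕ) :
    expo i j k l = expo i' j' k' l' ↔ i = i' ∧ j = j' ∧ k = k' ∧ l = l' := by
  simp [expo]

lemma expo_sub_expo (i j k l i' j' k' l' : ℕ) :
    expo i j k l - expo i' j' k' l' = expo (i - i') (j - j') (k - k') (l - l') := by
  simp [Finsupp.ext_iff, Fin.forall_fin_succ, expo]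

lemma eq_expo (c : Fin 4 →₀ ℕ) : c = expo (c 0) (c 1) (c 2) (c 3) := by
  simp [Finsupp.ext_iff, Fin.forall_fin_succ, expo]

lemma wdeg_expo (r i j k l : ℕ) :
    wdeg r (expo i j k l) = ((i : ℤ) + k + r * l, (j : ℤ) + l) := by
  simp [wdeg, expo]

lemma monomial_expo (i j k l : ℕ) (t : ℂ) :
    (monomial (expo i j k l) t : S) = C t * X 0 ^ i * X 1 ^ j * X 2 ^ k * X 3 ^ l := by
  rw [monomial_eq, Finsupp.prod_fintype _ _ (by simp)]
  simp [Fin.prod_univ_four, expo, mul_assoc]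

lemma coeff_expo_monomial_mul (i j k l i' j' k' l' : ℕ) (t : ℂ) (p : S) :
    coeff (expo i j k l) (monomial (expo i' j' k' l') t * p) =
      if i' ≤ i ∧ j' ≤ j ∧ k' ≤ k ∧ l' ≤ l then
        t * coeff (expo (i - i') (j - j') (k - k') (l - l')) p else 0 := by
  simp only [coeff_monomial_mul', expo_le_expo, expo_sub_expo]

lemma coeff_expo_monomial (i j k l i' j' k' l' : ℕ) (t : ℂ) :
    coeff (expo i j k l) (monomial (expo i' j' k' l') t : S) =
      if i' = i ∧ j' = j ∧ k' = k ∧ l' = l then t else 0 := by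
  simp only [coeff_monomial, expo_inj]

/-- `x₁ ∂f/∂x₁` for the polynomial `f` of bidegree `(m + 5, 3)`. -/
def logDerivX (m : ℕ) : S :=
  monomial (expo (m + 5) 3 0 0) (m + 5 : ℂ) + monomial (expo (m + 2) 0 0 3) (m + 2 : ℂ)

/-- `x₃ ∂f/∂x₃` for the polynomial `f` of bidegree `(m + 5, 3)`. -/
def logDerivZ (m : ℕ) : S :=
  monomial (expo 0 3 (m + 5) 0) (m + 5 : ℂ) + monomial (expo 0 0 (m + 2) 3) (m + 2 : ℂ)

/-- One third of `x₂ ∂f/∂x₂` for the polynomial `f` of bidegree `(m + 5, 3)`. -/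
def logDerivY (m : ℕ) : S :=
  monomial (expo (m + 5) 3 0 0) (1 : ℂ) + monomial (expo 0 3 (m + 5) 0) (1 : ℂ)

/-- The polynomial `f` of bidegree `(m + 5, 3)`. -/
def sparsePoly (m : ℕ) : S :=
  X 0 ^ (m + 5) * X 1 ^ 3 + X 2 ^ (m + 2) * X 3 ^ 3
    + X 2 ^ (m + 5) * X 1 ^ 3 + X 0 ^ (m + 2) * X 3 ^ 3

lemma X_zero_mul_pderiv (m : ℕ) : X 0 * pderiv 0 (sparsePoly m) = logDerivX m := by
  simp [sparsePoly, logDerivX, monomial_expo, pderiv_X, map_ofNat C]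
  ring

lemma X_one_mul_pderiv (m : ℕ) : X 1 * pderiv 1 (sparsePoly m) = 3 * logDerivY m := by
  simp [sparsePoly, logDerivY, monomial_expo, pderiv_X]
  ring

lemma X_two_mul_pderiv (m : ℕ) : X 2 * pderiv 2 (sparsePoly m) = logDerivZ m := by
  simp [sparsePoly, logDerivZ, monomial_expo, pderiv_X, map_ofNat C]
  ring

lemma X_three_mul_pderiv (m : ℕ) :
    X 3 * pderiv 3 (sparsePoly m) = 3 * X 3 ^ 3 * (X 0 ^ (m + 2) + X 2 ^ (m + 2)) := by
  simp [sparsePoly, pderiv_X]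
  ring

lemma C_add_two_mul_logDeriv (m : ℕ) :
    C (m + 2 : ℂ) * (X 3 ^ 3 * (X 0 ^ (m + 2) + X 2 ^ (m + 2))) =
      logDerivX m + logDerivZ m - C (m + 5 : ℂ) * logDerivY m := by
  simp only [logDerivX, logDerivY, logDerivZ, monomial_expo, map_add, map_one]
  ring

lemma natCast_add_two_ne_zero (m : ℕ) : (m + 2 : ℂ) ≠ 0 := by exact_mod_cast (by omega : m + 2 ≠ 0)

lemma natCast_add_five_ne_zero (m : ℕ) : (m + 5 : ℂ) ≠ 0 := by
  exact_mod_cast (by omega : m + 5 ≠ 0)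

lemma X_three_pow_mul_eq (m : ℕ) :
    X 3 ^ 3 * (X 0 ^ (m + 2) + X 2 ^ (m + 2)) =
      C ((m + 2 : ℂ)⁻¹) * (logDerivX m + logDerivZ m - C (m + 5 : ℂ) * logDerivY m) := by
  rw [← C_add_two_mul_logDeriv, ← mul_assoc, ← C_mul, inv_mul_cancel₀ (natCast_add_two_ne_zero m)]
  simp

lemma J0_sparsePoly (m : ℕ) :
    J0 (sparsePoly m) = Ideal.span {logDerivX m, logDerivZ m, logDerivY m} := by
  have hC : (C (3⁻¹ : ℂ) : S) * 3 = 1 := by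
    rw [show (3 : S) = C 3 from rfl, ← C_mul]; simp
  apply le_antisymm
  · have hx : logDerivX m ∈ Ideal.span {logDerivX m, logDerivZ m, logDerivY m} :=
      Ideal.subset_span (by simp)
    have hz : logDerivZ m ∈ Ideal.span {logDerivX m, logDerivZ m, logDerivY m} :=
      Ideal.subset_span (by simp)
    have hy : logDerivY m ∈ Ideal.span {logDerivX m, logDerivZ m, logDerivY m} :=
      Ideal.subset_span (by simp)
    refine Ideal.span_le.2 ?_
    rintro g ⟨i, rfl⟩
    fin_cases i
    · exact (X_zero_mul_pderiv m).symm ▸ hx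
    · exact (X_one_mul_pderiv m).symm ▸ Ideal.mul_mem_left _ _ hy
    · exact (X_two_mul_pderiv m).symm ▸ hz
    · refine (X_three_mul_pderiv m).symm ▸ ?_
      rw [mul_assoc, X_three_pow_mul_eq]
      exact Ideal.mul_mem_left _ _ (Ideal.mul_mem_left _ _
        (sub_mem (add_mem hx hz) (Ideal.mul_mem_left _ _ hy)))
  · refine Ideal.span_le.2 ?_
    rintro g (rfl | rfl | rfl)
    · exact Ideal.subset_span ⟨0, (X_zero_mul_pderiv m).symm⟩
    · exact Ideal.subset_span ⟨2, (X_two_mul_pderiv m).symm⟩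
    · have h : 3 * logDerivY m ∈ J0 (sparsePoly m) :=
        Ideal.subset_span ⟨1, (X_one_mul_pderiv m).symm⟩
      have h' := Ideal.mul_mem_left _ (C (3⁻¹ : ℂ)) h
      rwa [← mul_assoc, hC, one_mul] at h'

lemma mem_J1_sparsePoly (m : ℕ) (h : S) :
    h ∈ J1 (sparsePoly m) ↔ ∃ a b c : S,
      a * logDerivX m + b * logDerivZ m + c * logDerivY m = h * (X 0 * X 1 * X 2 * X 3) := by
  rw [J1, Ideal.submodule_span_eq.symm, Submodule.mem_colon_span_singleton, J0_sparsePoly,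
    smul_eq_mul, Ideal.span, Submodule.mem_span_triple]
  rfl

/-- A basis of the graded piece of `J₁(f)` in degree `(m + 5, 3)`. -/
def pieceBasis (m : ℕ) : Fin 7 → S :=
  ![monomial (expo (m + 3) 1 0 2) 1 + monomial (expo 1 1 (m + 2) 2) 1,
    monomial (expo (m + 2) 1 1 2) 1 + monomial (expo 0 1 (m + 3) 2) 1,
    monomial (expo (m + 5) 3 0 0) (m + 5 : ℂ) + monomial (expo (m + 2) 0 0 3) (m + 2 : ℂ),
    monomial (expo (m + 4) 3 1 0) (m + 5 : ℂ) + monomial (expo (m + 1) 0 1 3) (m + 2 : ℂ),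
    monomial (expo 0 3 (m + 5) 0) (m + 5 : ℂ) + monomial (expo 0 0 (m + 2) 3) (m + 2 : ℂ),
    monomial (expo 1 3 (m + 4) 0) (m + 5 : ℂ) + monomial (expo 1 0 (m + 1) 3) (m + 2 : ℂ),
    monomial (expo (m + 5) 3 0 0) 1 + monomial (expo 0 3 (m + 5) 0) 1]

lemma monomial_mem_Sgr {r : ℕ} {γ : ℤ × ℤ} {c : Fin 4 →₀ ℕ} (t : ℂ) (hc : wdeg r c = γ) :
    (monomial c t : S) ∈ Sgr r γ := by
  intro c' hc'
  rw [Finset.mem_singleton.1 (support_monomial_subset hc'), hc]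

lemma pieceBasis_mem_Sgr (m : ℕ) (i : Fin 7) :
    pieceBasis m i ∈ Sgr 1 (((m + 5 : ℕ) : ℤ), 3) := by
  fin_cases i <;>
    exact add_mem (monomial_mem_Sgr _ (by simp [wdeg_expo] <;> ring))
      (monomial_mem_Sgr _ (by simp [wdeg_expo] <;> ring))

lemma pieceBasis_mem_J1 (m : ℕ) (i : Fin 7) : pieceBasis m i ∈ J1 (sparsePoly m) := by
  rw [mem_J1_sparsePoly]
  fin_cases i
  · refine ⟨C ((m + 2 : ℂ)⁻¹) * (X 0 ^ 2 * X 1 ^ 2 * X 2),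
      C ((m + 2 : ℂ)⁻¹) * (X 0 ^ 2 * X 1 ^ 2 * X 2),
      - (C ((m + 2 : ℂ)⁻¹) * C (m + 5 : ℂ) * (X 0 ^ 2 * X 1 ^ 2 * X 2)), ?_⟩
    simp only [pieceBasis, monomial_expo, map_one, Fin.zero_eta, Matrix.cons_val_zero]
    linear_combination -(X 0 ^ 2 * X 1 ^ 2 * X 2) * X_three_pow_mul_eq m
  · refine ⟨C ((m + 2 : ℂ)⁻¹) * (X 0 * X 1 ^ 2 * X 2 ^ 2),
      C ((m + 2 : ℂ)⁻¹) * (X 0 * X 1 ^ 2 * X 2 ^ 2),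
      - (C ((m + 2 : ℂ)⁻¹) * C (m + 5 : ℂ) * (X 0 * X 1 ^ 2 * X 2 ^ 2)), ?_⟩
    simp only [pieceBasis, monomial_expo, map_one, Fin.mk_one, Matrix.cons_val_one,
      Matrix.cons_val_zero]
    linear_combination -(X 0 * X 1 ^ 2 * X 2 ^ 2) * X_three_pow_mul_eq m
  · refine ⟨X 0 * X 1 * X 2 * X 3, 0, 0, ?_⟩
    simp [pieceBasis, monomial_expo, logDerivX]; ring
  · refine ⟨X 1 * X 2 ^ 2 * X 3, 0, 0, ?_⟩
    simp [pieceBasis, monomial_expo, logDerivX]; ring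
  · refine ⟨0, X 0 * X 1 * X 2 * X 3, 0, ?_⟩
    simp [pieceBasis, monomial_expo, logDerivZ]; ring
  · refine ⟨0, X 0 ^ 2 * X 1 * X 3, 0, ?_⟩
    simp [pieceBasis, monomial_expo, logDerivZ]; ring
  · refine ⟨0, 0, X 0 * X 1 * X 2 * X 3, ?_⟩
    simp [pieceBasis, monomial_expo, logDerivY]; ring

lemma linearIndependent_pieceBasis (m : ℕ) : LinearIndependent ℂ (pieceBasis m) := by
  have h2 := natCast_add_two_ne_zero m
  have h5 := natCast_add_five_ne_zero m
  rw [Fintype.linearIndependent_iff]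
  intro g hg
  have key (i j k l : ℕ) : coeff (expo i j k l) (∑ t, g t • pieceBasis m t) = 0 := by
    rw [hg, coeff_zero]
  simp only [Fin.sum_univ_seven, pieceBasis, coeff_add, coeff_smul, coeff_expo_monomial,
    smul_eq_mul, Matrix.cons_val] at key
  have e0 : g 0 = 0 := by simpa using key (m + 3) 1 0 2
  have e1 : g 1 = 0 := by simpa using key (m + 2) 1 1 2
  have e2 : g 2 = 0 := by simpa [h2] using key (m + 2) 0 0 3
  have e3 : g 3 = 0 := by simpa [h5] using key (m + 4) 3 1 0
  have e4 : g 4 = 0 := by simpa [h2] using key 0 0 (m + 2) 3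
  have e5 : g 5 = 0 := by simpa [h5] using key 1 3 (m + 4) 0
  have e6 : g 6 = 0 := by simpa [e2] using key (m + 5) 3 0 0
  intro t
  fin_cases t <;> assumption

lemma eq_of_coeff_expo_eq {n : ℕ} {p q : S} (hp : p ∈ Sgr 1 ((n : ℤ), 3))
    (hq : q ∈ Sgr 1 ((n : ℤ), 3))
    (h : ∀ i j k l : ℕ, i + k + l = n → j + l = 3 →
      coeff (expo i j k l) p = coeff (expo i j k l) q) : p = q := by
  ext c
  by_cases hc : wdeg 1 c = ((n : ℤ), 3)
  · rw [eq_expo c] at hc ⊢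
    rw [wdeg_expo, Prod.mk.injEq] at hc
    exact h _ _ _ _ (by omega) (by omega)
  · rw [notMem_support_iff.1 fun h' => hc (hp c h'), notMem_support_iff.1 fun h' => hc (hq c h')]

lemma mem_span_pieceBasis (m : ℕ) {h : S} (hJ : h ∈ J1 (sparsePoly m))
    (hS : h ∈ Sgr 1 (((m + 5 : ℕ) : ℤ), 3)) :
    h ∈ Submodule.span ℂ (Set.range (pieceBasis m)) := by
  have h2 := natCast_add_two_ne_zero m
  have h5 := natCast_add_five_ne_zero m
  obtain ⟨a, b, c, habc⟩ := (mem_J1_sparsePoly m h).1 hJ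
  have hX : (X 0 * X 1 * X 2 * X 3 : S) = monomial (expo 1 1 1 1) 1 := by
    simp [monomial_expo]
  have hv := pieceBasis_mem_Sgr m
  rw [hX] at habc
  simp only [logDerivX, logDerivY, logDerivZ] at habc
  rw [Submodule.mem_span_range_iff_exists_fun]
  unfold pieceBasis at hv ⊢
  generalize (m + 2 : ℂ) = E at *
  generalize (m + 5 : ℂ) = D at *
  have key (i j k l : ℕ) := congrArg (coeff (expo i j k l)) habc
  simp only [mul_comm _ (monomial _ _ + monomial _ _), add_mul,
    coeff_add, mul_comm h, coeff_expo_monomial_mul, one_mul] at key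
  have a2101 : coeff (expo 2 1 0 1) a = 0 := by simpa [h2] using key (m + 4) 1 0 4
  have b0121 : coeff (expo 0 1 2 1) b = 0 := by simpa [h2] using key 0 1 (m + 4) 4
  have c2101 : coeff (expo 2 1 0 1) c = 0 := by simpa [a2101] using key (m + 7) 4 0 1
  have c0121 : coeff (expo 0 1 2 1) c = 0 := by simpa [b0121] using key 0 4 (m + 7) 1
  have a3200 : coeff (expo 3 2 0 0) a = 0 := by simpa [h2] using key (m + 5) 2 0 3
  have b0230 : coeff (expo 0 2 3 0) b = 0 := by simpa [h2] using key 0 2 (m + 5) 3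
  have ca3200 : D * coeff (expo 3 2 0 0) a + coeff (expo 3 2 0 0) c = 0 := by
    simpa using key (m + 8) 5 0 0
  have ca2210 : D * coeff (expo 2 2 1 0) a + coeff (expo 2 2 1 0) c = 0 := by
    simpa using key (m + 7) 5 1 0
  have ca1220 : D * coeff (expo 1 2 2 0) a + coeff (expo 1 2 2 0) c = 0 := by
    simpa using key (m + 6) 5 2 0
  have ca0230 : D * coeff (expo 0 2 3 0) a + coeff (expo 0 2 3 0) c = 0 := by
    simpa using key (m + 5) 5 3 0
  have cb3200 : D * coeff (expo 3 2 0 0) b + coeff (expo 3 2 0 0) c = 0 := by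
    simpa using key 3 5 (m + 5) 0
  have cb2210 : D * coeff (expo 2 2 1 0) b + coeff (expo 2 2 1 0) c = 0 := by
    simpa using key 2 5 (m + 6) 0
  have cb1220 : D * coeff (expo 1 2 2 0) b + coeff (expo 1 2 2 0) c = 0 := by
    simpa using key 1 5 (m + 7) 0
  have cb0230 : D * coeff (expo 0 2 3 0) b + coeff (expo 0 2 3 0) c = 0 := by
    simpa using key 0 5 (m + 8) 0
  have ab {p q r s : ℕ} (ha : D * coeff (expo p q r s) a + coeff (expo p q r s) c = 0)
      (hb : D * coeff (expo p q r s) b + coeff (expo p q r s) c = 0) :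
      coeff (expo p q r s) b = coeff (expo p q r s) a :=
    mul_left_cancel₀ h5 (by linear_combination hb - ha)
  have b3200 := (ab ca3200 cb3200).trans a3200
  have a0230 := (ab ca0230 cb0230).symm.trans b0230
  have b2210 := ab ca2210 cb2210
  have b1220 := ab ca1220 cb1220
  have a0012 : coeff (expo 0 0 1 2) a = 0 := by simpa [h2] using key (m + 2) 0 1 5
  have a1002 : coeff (expo 1 0 0 2) a = 0 := by simpa [h2] using key (m + 3) 0 0 5
  have b0012 : coeff (expo 0 0 1 2) b = 0 := by simpa [h2] using key 0 0 (m + 3) 5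
  have b1002 : coeff (expo 1 0 0 2) b = 0 := by simpa [h2] using key 1 0 (m + 2) 5
  have c1002 : coeff (expo 1 0 0 2) c = 0 := by simpa [a1002] using key (m + 6) 3 0 2
  have c0012 : coeff (expo 0 0 1 2) c = 0 := by simpa [b0012] using key 0 3 (m + 6) 2
  refine ⟨![E * coeff (expo 2 2 1 0) a, E * coeff (expo 1 2 2 0) a, coeff (expo 1 1 1 1) a,
    coeff (expo 0 1 2 1) a, coeff (expo 1 1 1 1) b, coeff (expo 2 1 0 1) b,
    coeff (expo 1 1 1 1) c], ?_⟩
  refine eq_of_coeff_expo_eq (sum_mem fun i _ => Submodule.smul_mem _ _ (hv i)) hS ?_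
  intro i j k l hi hj
  have H := key (i + 1) (j + 1) (k + 1) (l + 1)
  simp only [Nat.le_add_left, and_true, if_true, Nat.add_sub_cancel] at H
  rw [← H]
  simp only [Fin.sum_univ_seven, coeff_add, coeff_smul, coeff_expo_monomial,
    smul_eq_mul, Matrix.cons_val]
  obtain rfl | rfl | rfl | rfl : l = 0 ∨ l = 1 ∨ l = 2 ∨ l = 3 := by omega
  · obtain rfl : j = 3 := by omega
    obtain rfl | rfl | rfl | rfl | ⟨hi2, hk2⟩ :
        k = 0 ∨ k = 1 ∨ i = 0 ∨ i = 1 ∨ 2 ≤ i ∧ 2 ≤ k := by omega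
    · obtain rfl : i = m + 5 := by omega
      simp
      ring
    · obtain rfl : i = m + 4 := by omega
      simp [c0121]
      ring
    · obtain rfl : k = m + 5 := by omega
      simp
      ring
    · obtain rfl : k = m + 4 := by omega
      simp [c2101]
      ring
    · simp (disch := omega) only [if_neg]
      ring
  · obtain rfl : j = 2 := by omega
    obtain rfl | rfl | ⟨hi1, hk1⟩ : k = 0 ∨ i = 0 ∨ 1 ≤ i ∧ 1 ≤ k := by omega
    · obtain rfl : i = m + 4 := by omega
      simp [a0012, c0012]
    · obtain rfl : k = m + 4 := by omega
      simp [b1002, c1002]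
    · simp (disch := omega) only [if_neg]
      ring
  · obtain rfl : j = 1 := by omega
    have hA : (if m + 2 ≤ i + 1 then E * coeff (expo (i + 1 - (m + 2)) 2 (k + 1) 0) a else 0) =
        (if m + 3 = i ∧ 0 = k then E * coeff (expo 2 2 1 0) a else 0)
          + if m + 2 = i ∧ 1 = k then E * coeff (expo 1 2 2 0) a else 0 := by
      obtain rfl | rfl | rfl | hk : k = 0 ∨ k = 1 ∨ k = 2 ∨ 3 ≤ k := by omega
      · obtain rfl : i = m + 3 := by omega
        simp
      · obtain rfl : i = m + 2 := by omega
        simp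
      · obtain rfl : i = m + 1 := by omega
        simp [a0230]
      · simp (disch := omega) only [if_neg, add_zero]
    have hB : (if m + 2 ≤ k + 1 then E * coeff (expo (i + 1) 2 (k + 1 - (m + 2)) 0) b else 0) =
        (if 1 = i ∧ m + 2 = k then E * coeff (expo 2 2 1 0) a else 0)
          + if 0 = i ∧ m + 3 = k then E * coeff (expo 1 2 2 0) a else 0 := by
      obtain rfl | rfl | rfl | hi : i = 0 ∨ i = 1 ∨ i = 2 ∨ 3 ≤ i := by omega
      · obtain rfl : k = m + 3 := by omega
        simp [b1220]
      · obtain rfl : k = m + 2 := by omega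
        simp [b2210]
      · obtain rfl : k = m + 1 := by omega
        simp [b3200]
      · simp (disch := omega) only [if_neg, add_zero]
    simp [mul_add] at hA hB ⊢
    linear_combination -hA - hB
  · obtain rfl : j = 0 := by omega
    have hA : (if m + 2 ≤ i + 1 then E * coeff (expo (i + 1 - (m + 2)) 1 (k + 1) 1) a else 0) =
        (if m + 2 = i ∧ 0 = k then coeff (expo 1 1 1 1) a * E else 0)
          + if m + 1 = i ∧ 1 = k then coeff (expo 0 1 2 1) a * E else 0 := by
      obtain rfl | rfl | hk : k = 0 ∨ k = 1 ∨ 2 ≤ k := by omega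
      · obtain rfl : i = m + 2 := by omega
        simp [mul_comm]
      · obtain rfl : i = m + 1 := by omega
        simp [mul_comm]
      · simp (disch := omega) only [if_neg, add_zero]
    have hB : (if m + 2 ≤ k + 1 then E * coeff (expo (i + 1) 1 (k + 1 - (m + 2)) 1) b else 0) =
        (if 0 = i ∧ m + 2 = k then coeff (expo 1 1 1 1) b * E else 0)
          + if 1 = i ∧ m + 1 = k then coeff (expo 2 1 0 1) b * E else 0 := by
      obtain rfl | rfl | hi : i = 0 ∨ i = 1 ∨ 2 ≤ i := by omega
      · obtain rfl : k = m + 2 := by omega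
        simp [mul_comm]
      · obtain rfl : k = m + 1 := by omega
        simp [mul_comm]
      · simp (disch := omega) only [if_neg, add_zero]
    simp at hA hB ⊢
    linear_combination -hA - hB

lemma J1_inf_Sgr_eq_span (m : ℕ) :
    Submodule.restrictScalars ℂ (J1 (sparsePoly m)) ⊓ Sgr 1 (((m + 5 : ℕ) : ℤ), 3) =
      Submodule.span ℂ (Set.range (pieceBasis m)) := by
  refine le_antisymm (fun h hh => mem_span_pieceBasis m hh.1 hh.2) (Submodule.span_le.2 ?_)
  rintro _ ⟨i, rfl⟩
  exact ⟨pieceBasis_mem_J1 m i, pieceBasis_mem_Sgr m i⟩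

lemma finrank_J1_inf_Sgr (m : ℕ) :
    Module.finrank ℂ
      ↥(Submodule.restrictScalars ℂ (J1 (sparsePoly m)) ⊓ Sgr 1 (((m + 5 : ℕ) : ℤ), 3)) = 7 := by
  rw [J1_inf_Sgr_eq_span, finrank_span_eq_card (linearIndependent_pieceBasis m), Fintype.card_fin]

/-- The exponent vectors of degree `(m + 5, 3)`. -/
def pieceExponents (m : ℕ) : Finset (Fin 4 →₀ ℕ) :=
  ((Finset.range 4).sigma fun l => Finset.range (m + 6 - l)).image
    fun p => expo p.2 (3 - p.1) (m + 5 - p.1 - p.2) p.1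

lemma coe_pieceExponents (m : ℕ) :
    (pieceExponents m : Set (Fin 4 →₀ ℕ)) = {c | wdeg 1 c = (((m + 5 : ℕ) : ℤ), 3)} := by
  ext c
  simp only [pieceExponents, Finset.coe_image, Set.mem_image, Finset.mem_coe, Finset.mem_sigma,
    Finset.mem_range, Set.mem_ofPred_eq]
  constructor
  · rintro ⟨⟨l, i⟩, ⟨hl, hi⟩, rfl⟩
    dsimp only at hl hi ⊢
    rw [wdeg_expo, Prod.mk.injEq]
    omega
  · intro hc
    simp only [wdeg, Prod.mk.injEq] at hc
    refine ⟨⟨c 3, c 0⟩, ⟨by dsimp only; omega, by dsimp only; omega⟩, ?_⟩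
    conv_rhs => rw [eq_expo c]
    rw [expo_inj]
    dsimp only
    omega

lemma card_pieceExponents (m : ℕ) : (pieceExponents m).card = 4 * (m + 5) - 2 := by
  rw [pieceExponents, Finset.card_image_of_injOn, Finset.card_sigma]
  · simp only [Finset.card_range, Finset.sum_range_succ, Finset.sum_range_zero]
    omega
  · rintro ⟨l, i⟩ - ⟨l', i'⟩ - h
    obtain ⟨rfl, -, -, rfl⟩ := (expo_inj _ _ _ _ _ _ _ _).1 h
    rfl

lemma Sgr_eq_restrictSupport (m : ℕ) :
    Sgr 1 (((m + 5 : ℕ) : ℤ), 3) = restrictSupport ℂ (pieceExponents m : Set (Fin 4 →₀ ℕ)) := by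
  rw [coe_pieceExponents]
  rfl

instance finite_Sgr (m : ℕ) : Module.Finite ℂ (Sgr 1 (((m + 5 : ℕ) : ℤ), 3)) := by
  rw [Sgr_eq_restrictSupport]
  exact Module.Finite.of_basis (basisRestrictSupport ℂ _)

lemma finrank_Sgr (m : ℕ) :
    Module.finrank ℂ (Sgr 1 (((m + 5 : ℕ) : ℤ), 3)) = 4 * (m + 5) - 2 := by
  rw [Sgr_eq_restrictSupport, Module.finrank_eq_card_basis (basisRestrictSupport ℂ _)]
  simp [card_pieceExponents]

lemma finrank_R1_add (r : ℕ) (f : S) (γ : ℤ × ℤ) [Module.Finite ℂ (Sgr r γ)] :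
    Module.finrank ℂ (R1 r f γ) +
      Module.finrank ℂ ↥(Submodule.restrictScalars ℂ (J1 f) ⊓ Sgr r γ) =
      Module.finrank ℂ (Sgr r γ) := by
  set φ : S →ₗ[ℂ] S ⧸ J1 f := (Ideal.Quotient.mkₐ ℂ (J1 f)).toLinearMap with hφ
  have hker : LinearMap.ker φ = Submodule.restrictScalars ℂ (J1 f) := by
    ext x
    simp [hφ, Ideal.Quotient.eq_zero_iff_mem]
  have h := LinearMap.finrank_range_add_finrank_ker (φ.domRestrict (Sgr r γ))
  rw [LinearMap.range_domRestrict, LinearMap.ker_domRestrict, hker] at h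
  rwa [(Submodule.equivSubtypeMap _ _).finrank_eq, Submodule.map_comap_subtype, inf_comm] at h

/-- for `r = 1`, `5 ≤ d ≤ 10`, and the explicit `f ∈ S_{(d,3)}`,
`dim_ℂ R₁(f)_{(d,3)} = 4d − 9`; equivalently, since `dim_ℂ S_{(d,3)} = 4d − 2`,
`dim_ℂ (J₁(f) ∩ S_{(d,3)}) = 7`. -/
theorem stmt_5 (d : ℕ) (hd5 : 5 ≤ d) (hd10 : d ≤ 10) (f : S)
    (hf : f = X 0 ^ d * X 1 ^ 3 + X 2 ^ (d - 3) * X 3 ^ 3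
            + X 2 ^ d * X 1 ^ 3 + X 0 ^ (d - 3) * X 3 ^ 3) :
    Module.finrank ℂ ↥(R1 1 f ((d : ℤ), 3)) = 4 * d - 9 ∧
    Module.finrank ℂ ↥(Sgr 1 ((d : ℤ), 3)) = 4 * d - 2 ∧
    Module.finrank ℂ
        ↥(Submodule.restrictScalars ℂ (J1 f) ⊓ Sgr 1 ((d : ℤ), 3)) = 7 := by
  obtain ⟨m, rfl⟩ := Nat.exists_eq_add_of_le' hd5
  obtain rfl : f = sparsePoly m := hf
  have h := finrank_R1_add 1 (sparsePoly m) (((m + 5 : ℕ) : ℤ), 3)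
  rw [finrank_J1_inf_Sgr, finrank_Sgr] at h
  exact ⟨by omega, finrank_Sgr m, finrank_J1_inf_Sgr m⟩
end
end

section
/- (Theorem: trigonal curves with trigonal deformations of rank g.) Let r = 1 and let d be an integer with 5 ≤ d ≤ 10, and let f = x₁^d x₂³ + x₃^{d−3}x₄³ + x₃^d x₂³ + x₁^{d−3}x₄³ ∈ S_{(d,3)} (a nondegenerate section of dD₁ + 3D₂ on the Hirzebruch surface ℋ₁ = Bl_p ℙ²). Then there exists η ∈ S_{(d,3)} such that the multiplication map R₁(f)_{(d−3,1)} → R₁(f)_{(2d−3,4)}, [α] ↦ [η·α], is injective; since dim_ℂ R₁(f)_{(d−3,1)} = 2d − 5 = g is the genus of the trigonal curve {f = 0}, this map has rank g. (Via the Batyrev–Cox identification R₁(f)_{β+K} ≅ H^0(C,ω_C), R₁(f)_{2β+K} ≅ H^1(C,O_C), this says the curve {f=0} admits a first-order deformation inside ℋ₁ of rank g.) -/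
open MvPolynomial

noncomputable section

/-- The monomial `x₁^a x₂^b x₃^c x₄^e`. -/
def mono (a b c e : ℕ) : S := X 0 ^ a * X 1 ^ b * X 2 ^ c * X 3 ^ e

theorem mono_mul_mono (a b c e a' b' c' e' : ℕ) :
    mono a b c e * mono a' b' c' e' = mono (a + a') (b + b') (c + c') (e + e') := by
  simp only [mono]; ring

theorem monomial_one_eq_mono (m : Fin 4 →₀ ℕ) :
    (monomial m 1 : S) = mono (m 0) (m 1) (m 2) (m 3) := by
  rw [monomial_eq, Finsupp.prod_fintype _ _ (by simp)]
  simp [Fin.prod_univ_four, mono]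

/-- The exponent vector `(a, b, c, e)`. -/
def expVec (a b c e : ℕ) : Fin 4 →₀ ℕ := Finsupp.equivFunOnFinite.symm ![a, b, c, e]

@[simp] theorem expVec_zero (a b c e : ℕ) : expVec a b c e 0 = a := rfl
@[simp] theorem expVec_one (a b c e : ℕ) : expVec a b c e 1 = b := rfl
@[simp] theorem expVec_two (a b c e : ℕ) : expVec a b c e 2 = c := rfl
@[simp] theorem expVec_three (a b c e : ℕ) : expVec a b c e 3 = e := rfl

theorem mono_eq_monomial (a b c e : ℕ) : mono a b c e = monomial (expVec a b c e) 1 := by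
  simp [monomial_one_eq_mono]

theorem expVec_ext {m m' : Fin 4 →₀ ℕ} (h0 : m 0 = m' 0) (h1 : m 1 = m' 1)
    (h2 : m 2 = m' 2) (h3 : m 3 = m' 3) : m = m' := by
  ext i
  fin_cases i <;> assumption

/-- The linear functional on `S` with prescribed values on monomials. -/
def monoFunctional (w : ℕ → ℕ → ℕ → ℕ → ℂ) : S →ₗ[ℂ] ℂ :=
  (basisMonomials (Fin 4) ℂ).constr ℂ fun m => w (m 0) (m 1) (m 2) (m 3)

theorem monoFunctional_mono (w : ℕ → ℕ → ℕ → ℕ → ℂ) (a b c e : ℕ) :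
    monoFunctional w (mono a b c e) = w a b c e := by
  have h := (basisMonomials (Fin 4) ℂ).constr_basis ℂ
    (fun m => w (m 0) (m 1) (m 2) (m 3)) (expVec a b c e)
  simpa [monoFunctional, mono_eq_monomial] using h

theorem linearMap_mul_eq_sum (φ : S →ₗ[ℂ] ℂ) (q α : S) :
    φ (q * α) = ∑ m ∈ α.support, α.coeff m * φ (q * mono (m 0) (m 1) (m 2) (m 3)) := by
  conv_lhs => rw [α.as_sum, Finset.mul_sum, map_sum]
  refine Finset.sum_congr rfl fun m _ => ?_
  rw [← monomial_one_eq_mono, ← smul_eq_mul (a := coeff m α), ← map_smul, ← mul_smul_comm,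
    smul_monomial, smul_eq_mul, mul_one]

theorem linearMap_eq_zero_of_mem_span {φ : S →ₗ[ℂ] ℂ} {s : Set S}
    (h : ∀ g ∈ s, ∀ a b c e : ℕ, φ (g * mono a b c e) = 0)
    {q : S} (hq : q ∈ Ideal.span s) : φ q = 0 := by
  suffices ∀ p : S, φ (q * p) = 0 by simpa using this 1
  induction hq using Submodule.span_induction with
  | mem x hx =>
    intro p
    rw [linearMap_mul_eq_sum]
    exact Finset.sum_eq_zero fun m _ => by rw [h x hx, mul_zero]
  | zero => simp
  | add x y _ _ hx hy => intro p; rw [add_mul, map_add, hx, hy, add_zero]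
  | smul a x _ hx =>
    intro p
    rw [smul_eq_mul, mul_comm a x, mul_assoc]
    exact hx _

theorem mem_J1_iff {f α : S} : α ∈ J1 f ↔ mono 1 1 1 1 * α ∈ J0 f := by
  have h1 : (X 0 * X 1 * X 2 * X 3 : S) = mono 1 1 1 1 := by simp [mono]
  rw [J1, h1, Submodule.mem_colon]
  constructor
  · intro h
    simpa [mul_comm] using h _ (Ideal.mem_span_singleton_self _)
  · intro h s hs
    obtain ⟨t, rfl⟩ := Ideal.mem_span_singleton'.mp hs
    rw [smul_eq_mul, show α * (t * mono 1 1 1 1) = t * (mono 1 1 1 1 * α) by ring]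
    exact Ideal.mul_mem_left _ _ h

theorem mono_mem_Sgr {r : ℕ} {γ : ℤ × ℤ} {a b c e : ℕ}
    (h : wdeg r (expVec a b c e) = γ) : mono a b c e ∈ Sgr r γ := by
  rw [mono_eq_monomial]
  intro m hm
  rwa [Finset.mem_singleton.mp (support_monomial_subset hm)]

theorem finrank_Sgr_s6 (r : ℕ) (γ : ℤ × ℤ) :
    Module.finrank ℂ (Sgr r γ) = Nat.card {m : Fin 4 →₀ ℕ // wdeg r m = γ} := by
  have h : Sgr r γ = restrictSupport ℂ {m | wdeg r m = γ} := by
    ext q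
    exact Iff.rfl
  rw [h]
  exact Module.finrank_eq_nat_card_basis (basisRestrictSupport ℂ _)

/-- The exponent vectors of degree `(n, 1)` on `ℋ₁`. -/
def expVecEquiv (n : ℕ) :
    {m : Fin 4 →₀ ℕ // wdeg 1 m = ((n : ℤ), 1)} ≃ Fin (n + 1) ⊕ Fin n where
  toFun m :=
    if h : m.1 3 = 0 then
      .inl ⟨m.1 0, by have := m.2; simp only [wdeg, Prod.mk.injEq] at this; omega⟩
    else .inr ⟨m.1 0, by have := m.2; simp only [wdeg, Prod.mk.injEq] at this; omega⟩
  invFun := Sum.elim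
    (fun i => ⟨expVec i 1 (n - i) 0, by simp [wdeg]; omega⟩)
    (fun i => ⟨expVec i 0 (n - 1 - i) 1, by simp [wdeg]; omega⟩)
  left_inv := by
    rintro ⟨m, hm⟩
    simp only [wdeg, Prod.mk.injEq] at hm
    by_cases h : m 3 = 0
    · simp only [h, dite_true, Sum.elim_inl, Subtype.mk.injEq]
      apply expVec_ext <;> simp <;> omega
    · simp only [h, dite_false, Sum.elim_inr, Subtype.mk.injEq]
      apply expVec_ext <;> simp <;> omega
  right_inv := by rintro (i | i) <;> simp

theorem X_mul_pderiv_mono (i : Fin 4) (a b c e : ℕ) :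
    X i * pderiv i (mono a b c e) = (expVec a b c e i : ℂ) • mono a b c e := by
  rw [mono_eq_monomial, X_mul_pderiv_monomial, Nat.cast_smul_eq_nsmul]

/-- Values on monomials of degree `2β`, `β = (n + 3, 3)`, of a functional which vanishes on
`J₀(f)`; it is supported on monomials whose `x₂`-exponent is `k` or `k + 3`. -/
def dualWeight (n k : ℕ) (g : ℕ → ℂ) (a b c e : ℕ) : ℂ :=
  if a + c + e = 2 * (n + 3) ∧ b + e = 6 then
    if b = k + 3 then (if a < n + 3 then g a else -g (a - (n + 3))) / (n + 3)
    else if b = k then (if a < n then -g a else g (a - n)) / n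
    else 0
  else 0

section dualWeight

variable {n k : ℕ} {g : ℕ → ℂ} (a b c e : ℕ)

theorem dualWeight_add_left_pow_x₂ (hk : k ≤ 2) :
    dualWeight n k g (n + 3 + a) (3 + b) (0 + c) (0 + e) =
      if a + c + e = n + 3 ∧ b + e = 3 ∧ b = k then -g a / (n + 3) else 0 := by
  unfold dualWeight
  split_ifs <;> first | omega | rfl | simp

theorem dualWeight_add_right_pow_x₂ (hk0 : 0 < k) (hk : k ≤ 2) :
    dualWeight n k g (0 + a) (3 + b) (n + 3 + c) (0 + e) =
      if a + c + e = n + 3 ∧ b + e = 3 ∧ b = k then g a / (n + 3) else 0 := by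
  unfold dualWeight
  split_ifs <;> first | omega | rfl | simp

theorem dualWeight_add_left_pow_x₄ (hk0 : 0 < k) :
    dualWeight n k g (n + a) (0 + b) (0 + c) (3 + e) =
      if a + c + e = n + 3 ∧ b + e = 3 ∧ b = k then g a / n else 0 := by
  unfold dualWeight
  split_ifs <;> first | omega | rfl | simp

theorem dualWeight_add_right_pow_x₄ (hk0 : 0 < k)
    (hg : ∀ j ≤ k, g (n + j) = -g j) :
    dualWeight n k g (0 + a) (0 + b) (n + c) (3 + e) =
      if a + c + e = n + 3 ∧ b + e = 3 ∧ b = k then -g a / n else 0 := by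
  by_cases ha : a < n
  · unfold dualWeight
    split_ifs <;> first | omega | rfl | simp
  · obtain ⟨j, rfl⟩ := Nat.exists_eq_add_of_le (not_lt.mp ha)
    unfold dualWeight
    split_ifs <;> first | omega | rfl | skip
    rw [hg j (by omega)]
    simp

end dualWeight

theorem monoFunctional_dualWeight_eq_zero {n k : ℕ} (hn : 0 < n) (hk0 : 0 < k) (hk : k ≤ 2)
    {g : ℕ → ℂ} (hg : ∀ j ≤ k, g (n + j) = -g j) {q : S}
    (hq : q ∈ J0 (mono (n + 3) 3 0 0 + mono 0 0 n 3 + mono 0 3 (n + 3) 0 + mono n 0 0 3)) :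
    monoFunctional (dualWeight n k g) q = 0 := by
  have hn0 : (n : ℂ) ≠ 0 := by exact_mod_cast hn.ne'
  have hn3 : (n + 3 : ℂ) ≠ 0 := by exact_mod_cast (Nat.succ_ne_zero (n + 2))
  refine linearMap_eq_zero_of_mem_span ?_ hq
  rintro _ ⟨i, rfl⟩ a b c e
  simp only [map_add, mul_add, X_mul_pderiv_mono, add_mul, smul_mul_assoc, map_smul,
    mono_mul_mono, monoFunctional_mono, dualWeight_add_left_pow_x₂ a b c e hk,
    dualWeight_add_right_pow_x₂ a b c e hk0 hk, dualWeight_add_left_pow_x₄ a b c e hk0,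
    dualWeight_add_right_pow_x₄ a b c e hk0 hg]
  split_ifs
  · fin_cases i <;> simp <;> field_simp <;> ring
  · simp

/-- A direction `η ∈ S_β`, `β = (n + 3, 3)`, for which multiplication is injective. -/
def deformation (n : ℕ) : S := mono 1 2 (n + 1) 1 + mono (n - 1) 1 2 2

theorem monoFunctional_mul_deformation {n : ℕ} (hn : 0 < n) (w : ℕ → ℕ → ℕ → ℕ → ℂ)
    (a b c e : ℕ) :
    monoFunctional w (mono 1 1 1 1 * deformation n * mono a b c e) =
      w (a + 2) (b + 3) (c + (n + 2)) (e + 2) + w (a + n) (b + 2) (c + 3) (e + 3) := by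
  simp only [deformation, mul_add, add_mul, mono_mul_mono, map_add, monoFunctional_mono]
  congr 2 <;> omega

theorem monoFunctional_dualWeight_one {n : ℕ} (hn : 0 < n) (g : ℕ → ℂ) {m : Fin 4 →₀ ℕ}
    (hm : wdeg 1 m = ((n : ℤ), 1)) :
    monoFunctional (dualWeight n 1 g)
        (mono 1 1 1 1 * deformation n * mono (m 0) (m 1) (m 2) (m 3)) =
      if m 3 = 0 then g (m 0 + 2) / (n + 3) else 0 := by
  simp only [wdeg, Prod.mk.injEq] at hm
  rw [monoFunctional_mul_deformation hn]
  unfold dualWeight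
  split_ifs <;> first | omega | simp

theorem monoFunctional_dualWeight_two {n : ℕ} (hn : 0 < n) (g : ℕ → ℂ) {m : Fin 4 →₀ ℕ}
    (hm : wdeg 1 m = ((n : ℤ), 1)) :
    monoFunctional (dualWeight n 2 g)
        (mono 1 1 1 1 * deformation n * mono (m 0) (m 1) (m 2) (m 3)) =
      if m 3 = 0 then 0 else g (m 0) / n := by
  simp only [wdeg, Prod.mk.injEq] at hm
  rw [monoFunctional_mul_deformation hn]
  unfold dualWeight
  split_ifs <;> first | omega | simp

theorem eq_of_wdeg_eq {n : ℕ} {m m' : Fin 4 →₀ ℕ} (hm : wdeg 1 m = ((n : ℤ), 1))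
    (hm' : wdeg 1 m' = ((n : ℤ), 1)) (h0 : m 0 = m' 0) (h3 : m 3 = 0 ↔ m' 3 = 0) : m = m' := by
  simp only [wdeg, Prod.mk.injEq] at hm hm'
  exact expVec_ext h0 (by omega) (by omega) (by omega)

theorem eq_zero_of_deformation_mul_mem {n : ℕ} (hn : 2 ≤ n) {α : S}
    (hα : α ∈ Sgr 1 ((n : ℤ), 1))
    (h : deformation n * α ∈
      J1 (mono (n + 3) 3 0 0 + mono 0 0 n 3 + mono 0 3 (n + 3) 0 + mono n 0 0 3)) :
    α = 0 := by
  have hn0 : (n : ℂ) ≠ 0 := by exact_mod_cast (by omega : n ≠ 0)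
  have hn3 : (n + 3 : ℂ) ≠ 0 := by exact_mod_cast (Nat.succ_ne_zero (n + 2))
  rw [mem_J1_iff, ← mul_assoc] at h
  by_contra hne
  obtain ⟨m, hm⟩ := Finset.nonempty_iff_ne_empty.mpr (mt support_eq_empty.mp hne)
  have hcoeff := mem_support_iff.mp hm
  have hd := hα m hm
  by_cases h3 : m 3 = 0
  · have h0 := monoFunctional_dualWeight_eq_zero (k := 1)
      (g := fun j => if j = m 0 + 2 then 1 else if j < 2 ∧ n + j = m 0 + 2 then -1 else 0)
      (by omega) one_pos one_le_two
      (fun j hj => by split_ifs <;> first | omega | simp) h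
    rw [linearMap_mul_eq_sum, Finset.sum_eq_single_of_mem m hm,
      monoFunctional_dualWeight_one (by omega) _ hd] at h0
    · simp [h3, hcoeff, hn3] at h0
    · intro m' hm' hmm
      rw [monoFunctional_dualWeight_one (by omega) _ (hα m' hm')]
      have hne0 : ¬(m' 0 = m 0 ∧ (m' 3 = 0 ↔ m 3 = 0)) := fun h =>
        hmm (eq_of_wdeg_eq (hα m' hm') hd h.1 h.2)
      split_ifs <;> first | omega | simp
  · have hlt : m 0 < n := by
      simp only [wdeg, Prod.mk.injEq] at hd
      omega
    have h0 := monoFunctional_dualWeight_eq_zero (k := 2)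
      (g := fun j => if j = m 0 then 1 else if j = n + m 0 then -1
        else if j = 2 * n + m 0 then 1 else 0)
      (by omega) two_pos le_rfl
      (fun j hj => by split_ifs <;> first | omega | simp) h
    rw [linearMap_mul_eq_sum, Finset.sum_eq_single_of_mem m hm,
      monoFunctional_dualWeight_two (by omega) _ hd] at h0
    · simp [h3, hcoeff, hn0] at h0
    · intro m' hm' hmm
      rw [monoFunctional_dualWeight_two (by omega) _ (hα m' hm')]
      have hne0 : ¬(m' 0 = m 0 ∧ (m' 3 = 0 ↔ m 3 = 0)) := fun h =>
        hmm (eq_of_wdeg_eq (hα m' hm') hd h.1 h.2)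
      have hd' := hα m' hm'
      simp only [wdeg, Prod.mk.injEq] at hd hd'
      split_ifs <;> first | omega | simp

/-- for `r = 1`, `5 ≤ d ≤ 10`, and the explicit nondegenerate
`f ∈ S_{(d,3)}`, there is `η ∈ S_{(d,3)}` such that the multiplication map
`R₁(f)_{(d−3,1)} → R₁(f)_{(2d−3,4)}`, `[α] ↦ [η·α]`, is injective (stated
elementwise: `η·α ∈ J₁(f) → α ∈ J₁(f)` for `α ∈ S_{(d−3,1)}`); its source has
dimension `2d − 5 = g`, the genus of the trigonal curve `{f = 0}`, so the map
has rank `g`. -/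
theorem stmt_6 (d : ℕ) (hd5 : 5 ≤ d) (hd10 : d ≤ 10) (f : S)
    (hf : f = X 0 ^ d * X 1 ^ 3 + X 2 ^ (d - 3) * X 3 ^ 3
            + X 2 ^ d * X 1 ^ 3 + X 0 ^ (d - 3) * X 3 ^ 3) :
    Module.finrank ℂ ↥(R1 1 f ((d : ℤ) - 3, 1)) = 2 * d - 5 ∧
    ∃ η ∈ Sgr 1 ((d : ℤ), 3),
      ∀ α ∈ Sgr 1 ((d : ℤ) - 3, 1), η * α ∈ J1 f → α ∈ J1 f := by
  obtain ⟨n, rfl⟩ := Nat.exists_eq_add_of_le' (show 3 ≤ d by omega)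
  have hf' : f = mono (n + 3) 3 0 0 + mono 0 0 n 3 + mono 0 3 (n + 3) 0 + mono n 0 0 3 := by
    rw [hf, Nat.add_sub_cancel]
    simp only [mono]
    ring
  rw [show ((n + 3 : ℕ) : ℤ) - 3 = n by simp]
  have inj : ∀ α ∈ Sgr 1 ((n : ℤ), 1), deformation n * α ∈ J1 f → α = 0 := fun α hα h =>
    eq_zero_of_deformation_mul_mem (by omega) hα (hf' ▸ h)
  refine ⟨?_, deformation n, ?_, fun α hα h => ?_⟩
  · rw [R1, ← LinearMap.range_domRestrict, LinearMap.finrank_range_of_inj, finrank_Sgr_s6,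
      Nat.card_congr (expVecEquiv n)]
    · simp
      omega
    · rw [injective_iff_map_eq_zero]
      rintro ⟨α, hα⟩ h
      have hJ : α ∈ J1 f := Ideal.Quotient.eq_zero_iff_mem.mp h
      exact Subtype.ext (inj α hα (Ideal.mul_mem_left _ _ hJ))
  · refine add_mem (mono_mem_Sgr ?_) (mono_mem_Sgr ?_) <;> simp [wdeg] <;> omega
  · rw [inj α hα h]
    exact zero_mem _
end
end

section
/- (Duality lemma for kernels of multiplication.) Let r ≥ 0, β = (a,b) ample, f ∈ S_β nondegenerate, K = (−r−2,−2). Assume dim_ℂ R₁(f)_{3β+2K} = 1 and that the multiplication pairings R₁(f)_{β+K} × R₁(f)_{2β+K} → R₁(f)_{3β+2K} and R₁(f)_β × R₁(f)_{2β+2K} → R₁(f)_{3β+2K} are nondegenerate. For 0 ≠ α ∈ R₁(f)_{β+K} and γ ∈ ℤ², let K_γ(α) denote the kernel of the multiplication map R₁(f)_γ → R₁(f)_{γ+β+K}, x ↦ x·α. Then: (i) R₁(f)_{2β+K}/K_{2β+K}(α) ≅ ℂ (is one-dimensional); (ii) the induced pairing R₁(f)_β/K_β(α) × R₁(f)_{β+K}/K_{β+K}(α)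 → R₁(f)_{2β+K}/K_{2β+K}(α) ≅ ℂ is perfect; in particular (iii) dim R₁(f)_β/K_β(α) = dim R₁(f)_{β+K}/K_{β+K}(α). -/
open MvPolynomial

noncomputable section

/-- A bilinear form and its flip have the same rank. -/
theorem LinearMap.finrank_range_flip {K M N : Type*} [Field K] [AddCommGroup M] [Module K M]
    [AddCommGroup N] [Module K N] [FiniteDimensional K N] (p : M →ₗ[K] N →ₗ[K] K) :
    Module.finrank K (LinearMap.range p.flip) = Module.finrank K (LinearMap.range p) := by
  have h : p.flip = (p.dualMap : Module.Dual K (Module.Dual K N) →ₗ[K] Module.Dual K M) ∘ₗ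
      (Module.evalEquiv K N).toLinearMap := by
    ext n m
    simp
  rw [h, LinearMap.range_comp_of_range_eq_top _ (LinearEquiv.range _)]
  exact LinearMap.finrank_range_dualMap_eq_finrank_range p

/-- Linear maps with the same kernel have the same rank. -/
theorem LinearMap.finrank_range_eq_of_ker_eq {K M N P : Type*} [Field K] [AddCommGroup M]
    [Module K M] [AddCommGroup N] [Module K N] [AddCommGroup P] [Module K P]
    {g : M →ₗ[K] N} {h : M →ₗ[K] P} (hgh : LinearMap.ker g = LinearMap.ker h) :
    Module.finrank K (LinearMap.range g) = Module.finrank K (LinearMap.range h) := by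
  rw [← g.quotKerEquivRange.finrank_eq, ← h.quotKerEquivRange.finrank_eq, hgh]

/-- If the pairing `(x, y) ↦ ℓ (x * y * α)` on `M × N` induces a nondegenerate pairing between
`α M` and `α N`, then `α M` and `α N` have the same dimension. -/
theorem Submodule.finrank_map_mulLeft_eq {K A : Type*} [Field K] [CommRing A] [Algebra K A]
    (M N : Submodule K A) [FiniteDimensional K N] (α : A) (ℓ : A →ₗ[K] K)
    (hM : ∀ x ∈ M, α * x ≠ 0 → ∃ y ∈ N, ℓ (x * y * α) ≠ 0)
    (hN : ∀ y ∈ N, α * y ≠ 0 → ∃ x ∈ M, ℓ (x * y * α) ≠ 0) :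
    Module.finrank K (M.map (LinearMap.mulLeft K α)) =
      Module.finrank K (N.map (LinearMap.mulLeft K α)) := by
  let p : M →ₗ[K] N →ₗ[K] K :=
    ((LinearMap.mul K A).compr₂ (ℓ ∘ₗ LinearMap.mulRight K α)).domRestrict₁₂ M N
  have hp (x : M) (y : N) : p x y = ℓ (x * y * α) := rfl
  have hkerM : LinearMap.ker (LinearMap.mulLeft K α ∘ₗ M.subtype) = LinearMap.ker p := by
    ext x
    simp only [LinearMap.mem_ker, LinearMap.comp_apply, Submodule.subtype_apply,
      LinearMap.mulLeft_apply]
    refine ⟨fun h => ?_, fun h => ?_⟩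
    · ext y
      rw [hp, show (x * y * α : A) = α * x * y by ring, h]
      simp
    · by_contra hne
      obtain ⟨y, hy, hxy⟩ := hM x x.2 hne
      exact hxy (LinearMap.congr_fun h ⟨y, hy⟩)
  have hkerN : LinearMap.ker (LinearMap.mulLeft K α ∘ₗ N.subtype) = LinearMap.ker p.flip := by
    ext y
    simp only [LinearMap.mem_ker, LinearMap.comp_apply, Submodule.subtype_apply,
      LinearMap.mulLeft_apply]
    refine ⟨fun h => ?_, fun h => ?_⟩
    · ext x
      rw [LinearMap.flip_apply, hp, show (x * y * α : A) = α * y * x by ring, h]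
      simp
    · by_contra hne
      obtain ⟨x, hx, hxy⟩ := hN y y.2 hne
      exact hxy (LinearMap.congr_fun h ⟨x, hx⟩)
  have hrange (L : Submodule K A) :
      L.map (LinearMap.mulLeft K α) = LinearMap.range (LinearMap.mulLeft K α ∘ₗ L.subtype) := by
    rw [LinearMap.range_comp, Submodule.range_subtype]
  rw [hrange M, hrange N, LinearMap.finrank_range_eq_of_ker_eq hkerM,
    LinearMap.finrank_range_eq_of_ker_eq hkerN, LinearMap.finrank_range_flip]

/-- A one-dimensional subspace carries a linear functional of the ambient space that is injective
on it. -/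
theorem Submodule.exists_dual_ne_zero_of_finrank_eq_one {K V : Type*} [Field K] [AddCommGroup V]
    [Module K V] {T : Submodule K V} (hT : Module.finrank K T = 1) :
    ∃ ℓ : V →ₗ[K] K, ∀ t ∈ T, t ≠ 0 → ℓ t ≠ 0 := by
  have : FiniteDimensional K T := Module.finite_of_finrank_eq_succ hT
  let e : T ≃ₗ[K] K := LinearEquiv.ofFinrankEq T K (by rw [hT, Module.finrank_self])
  obtain ⟨ℓ, hℓ⟩ := LinearMap.exists_extend e.toLinearMap
  refine ⟨ℓ, fun t ht ht0 h => ht0 ?_⟩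
  have he : e ⟨t, ht⟩ = 0 := (LinearMap.congr_fun hℓ ⟨t, ht⟩).symm.trans h
  simpa using he

theorem wdeg_add (r : ℕ) (c d : Fin 4 →₀ ℕ) : wdeg r (c + d) = wdeg r c + wdeg r d := by
  ext <;> simp [wdeg] <;> ring

theorem mul_mem_Sgr {r : ℕ} {γ γ' δ : ℤ × ℤ} {x y : S} (hx : x ∈ Sgr r γ) (hy : y ∈ Sgr r γ')
    (hδ : γ + γ' = δ) : x * y ∈ Sgr r δ := by
  intro c hc
  obtain ⟨d, hd, e, he, rfl⟩ := Finset.mem_add.mp (MvPolynomial.support_mul x y hc)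
  rw [wdeg_add, hx d hd, hy e he, hδ]

instance finiteDimensional_Sgr (r : ℕ) (γ : ℤ × ℤ) : FiniteDimensional ℂ (Sgr r γ) := by
  have hle : Sgr r γ ≤ restrictTotalDegree (Fin 4) ℂ (γ.1 + γ.2).toNat := by
    intro x hx
    rw [mem_restrictTotalDegree]
    refine Finset.sup_le fun c hc => ?_
    have h := hx c hc
    have h1 : (c 0 : ℤ) + c 2 + r * c 3 = γ.1 := congrArg Prod.fst h
    have h2 : (c 1 : ℤ) + c 3 = γ.2 := congrArg Prod.snd h
    have h3 : (0 : ℤ) ≤ r * c 3 := by positivity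
    rw [Finsupp.sum_fintype _ _ (fun _ => rfl), Fin.sum_univ_four]
    omega
  exact Submodule.finiteDimensional_of_le hle

instance finiteDimensional_R1 (r : ℕ) (f : S) (γ : ℤ × ℤ) : FiniteDimensional ℂ (R1 r f γ) := by
  unfold R1
  infer_instance

theorem mk_mem_R1 {r : ℕ} {γ : ℤ × ℤ} {x : S} (f : S) (hx : x ∈ Sgr r γ) :
    Ideal.Quotient.mk (J1 f) x ∈ R1 r f γ :=
  ⟨x, hx, rfl⟩

theorem exists_of_mem_R1 {r : ℕ} {f : S} {γ : ℤ × ℤ} {x : S ⧸ J1 f} (hx : x ∈ R1 r f γ) :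
    ∃ y ∈ Sgr r γ, Ideal.Quotient.mk (J1 f) y = x :=
  hx

/-- Duality lemma for kernels of multiplication.
For `0 ≠ α ∈ R₁(f)_{β+K}` (represented by `α ∈ S_{β+K}` with `α ∉ J₁(f)`), with
`K_γ(α)` the kernel of multiplication by `α` on `R₁(f)_γ`:
(i) `R₁(f)_{2β+K}/K_{2β+K}(α) ≅ ℂ` (the quotient, identified with the image of
multiplication by `α`, is one-dimensional);
(ii) the induced pairing `R₁(f)_β/K_β(α) × R₁(f)_{β+K}/K_{β+K}(α) → R₁(f)_{2β+K}/K_{2β+K}(α) ≅ ℂ`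
is perfect (stated elementwise: a class of `x` is nonzero in the quotient iff
`x·α ∉ J₁(f)`, and the pairing of the classes of `x,y` is nonzero iff `x·y·α ∉ J₁(f)`);
(iii) `dim R₁(f)_β/K_β(α) = dim R₁(f)_{β+K}/K_{β+K}(α)`. -/
theorem stmt_8 (r : ℕ) (a b : ℤ) (hβ : (r : ℤ) * b < a ∧ 0 < b)
    (f : S) (hf : f ∈ Sgr r (a, b)) (hnd : Nondeg f)
    (h3 : Module.finrank ℂ ↥(R1 r f (3 * a - 2 * r - 4, 3 * b - 4)) = 1)
    (hp1 : NondegPair r f (a - r - 2, b - 2) (2 * a - r - 2, 2 * b - 2))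
    (hp2 : NondegPair r f (a, b) (2 * a - 2 * r - 4, 2 * b - 4))
    (α : S) (hα : α ∈ Sgr r (a - r - 2, b - 2)) (hα0 : α ∉ J1 f) :
    Module.finrank ℂ ↥((R1 r f (2 * a - r - 2, 2 * b - 2)).map
        (LinearMap.mulLeft ℂ (Ideal.Quotient.mk (J1 f) α))) = 1 ∧
    ((∀ x ∈ Sgr r (a, b), x * α ∉ J1 f →
        ∃ y ∈ Sgr r (a - r - 2, b - 2), x * y * α ∉ J1 f) ∧
     (∀ y ∈ Sgr r (a - r - 2, b - 2), y * α ∉ J1 f →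
        ∃ x ∈ Sgr r (a, b), x * y * α ∉ J1 f)) ∧
    Module.finrank ℂ ↥((R1 r f (a, b)).map
        (LinearMap.mulLeft ℂ (Ideal.Quotient.mk (J1 f) α)))
      = Module.finrank ℂ ↥((R1 r f (a - r - 2, b - 2)).map
        (LinearMap.mulLeft ℂ (Ideal.Quotient.mk (J1 f) α))) := by
  have hxα {x : S} (hx : x ∈ Sgr r (a, b)) : x * α ∈ Sgr r (2 * a - r - 2, 2 * b - 2) :=
    mul_mem_Sgr hx hα (by ext <;> simp <;> ring)
  have hyα {y : S} (hy : y ∈ Sgr r (a - r - 2, b - 2)) :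
      y * α ∈ Sgr r (2 * a - 2 * r - 4, 2 * b - 4) :=
    mul_mem_Sgr hy hα (by ext <;> simp <;> ring)
  have hleft : ∀ x ∈ Sgr r (a, b), x * α ∉ J1 f →
      ∃ y ∈ Sgr r (a - r - 2, b - 2), x * y * α ∉ J1 f := by
    intro x hx hxα0
    obtain ⟨y, hy, hxy⟩ := hp1.2 _ (hxα hx) hxα0
    exact ⟨y, hy, by rwa [show x * y * α = y * (x * α) by ring]⟩
  have hright : ∀ y ∈ Sgr r (a - r - 2, b - 2), y * α ∉ J1 f →
      ∃ x ∈ Sgr r (a, b), x * y * α ∉ J1 f := by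
    intro y hy hyα0
    obtain ⟨x, hx, hxy⟩ := hp2.2 _ (hyα hy) hyα0
    exact ⟨x, hx, by rwa [mul_assoc]⟩
  refine ⟨?_, ⟨hleft, hright⟩, ?_⟩
  · have hle : (R1 r f (2 * a - r - 2, 2 * b - 2)).map
        (LinearMap.mulLeft ℂ (Ideal.Quotient.mk (J1 f) α)) ≤
        R1 r f (3 * a - 2 * r - 4, 3 * b - 4) := by
      rintro _ ⟨z, hz, rfl⟩
      obtain ⟨w, hw, rfl⟩ := exists_of_mem_R1 hz
      rw [LinearMap.mulLeft_apply, ← map_mul]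
      exact mk_mem_R1 f (mul_mem_Sgr hα hw (by ext <;> simp <;> ring))
    refine le_antisymm (h3 ▸ Submodule.finrank_mono hle) ?_
    rw [Submodule.one_le_finrank_iff]
    obtain ⟨w, hw, hαw⟩ := hp1.1 α hα hα0
    refine (Submodule.ne_bot_iff _).mpr
      ⟨_, Submodule.mem_map_of_mem (mk_mem_R1 f hw), ?_⟩
    rwa [LinearMap.mulLeft_apply, ← map_mul, Ne, Ideal.Quotient.eq_zero_iff_mem]
  · obtain ⟨ℓ, hℓ⟩ := Submodule.exists_dual_ne_zero_of_finrank_eq_one h3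
    have hℓ_ne {x y : S} (hx : x ∈ Sgr r (a, b)) (hy : y ∈ Sgr r (a - r - 2, b - 2))
        (hxy : x * y * α ∉ J1 f) : ℓ (Ideal.Quotient.mk (J1 f) x * Ideal.Quotient.mk (J1 f) y *
          Ideal.Quotient.mk (J1 f) α) ≠ 0 := by
      rw [← map_mul, ← map_mul]
      refine hℓ _ (mk_mem_R1 f ?_) (by rwa [Ne, Ideal.Quotient.eq_zero_iff_mem])
      rw [mul_assoc]
      exact mul_mem_Sgr hx (hyα hy) (by ext <;> simp <;> ring)
    have hmk_ne {x : S} (h : Ideal.Quotient.mk (J1 f) α * Ideal.Quotient.mk (J1 f) x ≠ 0) :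
        x * α ∉ J1 f := by
      rwa [← map_mul, Ne, Ideal.Quotient.eq_zero_iff_mem, mul_comm] at h
    refine Submodule.finrank_map_mulLeft_eq _ _ _ ℓ (fun z hz h => ?_) (fun z hz h => ?_)
    · obtain ⟨x, hx, rfl⟩ := exists_of_mem_R1 hz
      obtain ⟨y, hy, hxy⟩ := hleft x hx (hmk_ne h)
      exact ⟨_, mk_mem_R1 f hy, hℓ_ne hx hy hxy⟩
    · obtain ⟨y, hy, rfl⟩ := exists_of_mem_R1 hz
      obtain ⟨x, hx, hxy⟩ := hright y hy (hmk_ne h)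
      exact ⟨_, mk_mem_R1 f hx, hℓ_ne hx hy hxy⟩
end
end
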